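/- Let w = (w_1,…,w_n) be a permutation of {1,…,n} whose ad-pattern equals d^{α_1−1} a d^{α_2−1} a ⋯ a d^{α_k−1} for some composition (α_1,…,α_k) of n with k ≥ 2 and α_i ≥ 2 for all 1 ≤ i ≤ k. Then the chromatic quasisymmetric function of the labeled path P_w is not symmetric. -/

import Mathlib

/-- A proper coloring of a labeled graph on vertex set `Fin n` (vertex `v` represents
label `v+1`), with colors in `{1,2,...}`. -/
def properColoring {n : ℕ} (G : SimpleGraph (Fin n)) (c : Fin n → ℕ) : Prop :=
  ∀ u v : Fin n, G.Adj u v → c u ≠ c v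

/-- The ascent number of a coloring: the number of edges `uv` with `u < v` and `c u < c v`. -/
noncomputable def ascNum {n : ℕ} (G : SimpleGraph (Fin n)) (c : Fin n → ℕ) : ℕ :=
  Nat.card {p : Fin n × Fin n // p.1 < p.2 ∧ G.Adj p.1 p.2 ∧ c p.1 < c p.2}

/-- The descent number of a coloring: the number of edges `uv` with `u < v` and `c u > c v`. -/
noncomputable def desNum {n : ℕ} (G : SimpleGraph (Fin n)) (c : Fin n → ℕ) : ℕ :=
  Nat.card {p : Fin n × Fin n // p.1 < p.2 ∧ G.Adj p.1 p.2 ∧ c p.2 < c p.1}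

/-- The coloring `c` uses exactly the colors `1,…,L.length`, color `a` being used
exactly `L.get (a-1)` times. -/
def usesPalette {n : ℕ} (L : List ℕ) (c : Fin n → ℕ) : Prop :=
  (∀ v : Fin n, 1 ≤ c v ∧ c v ≤ L.length) ∧
  ∀ i : Fin L.length, Nat.card {v : Fin n // c v = (i : ℕ) + 1} = L.get i

/-- `NG G L k` is the number of proper colorings of `G` with ascent number `k`
and palette `L`. -/
noncomputable def NG {n : ℕ} (G : SimpleGraph (Fin n)) (L : List ℕ) (k : ℕ) : ℕ :=
  Nat.card {c : Fin n → ℕ // properColoring G c ∧ usesPalette L c ∧ ascNum G c = k}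

/-- `L` is a composition of `n`: a list of positive integers summing to `n`. -/
def IsComposition (n : ℕ) (L : List ℕ) : Prop :=
  (∀ a ∈ L, 0 < a) ∧ L.sum = n

/-- The chromatic quasisymmetric function of `G` is symmetric. -/
def cqfSymmetric {n : ℕ} (G : SimpleGraph (Fin n)) : Prop :=
  ∀ L M : List ℕ, IsComposition n L → IsComposition n M → List.Perm L M →
    ∀ k : ℕ, NG G L k = NG G M k

/-- The number of edges of `G`. -/
noncomputable def edgeCount {n : ℕ} (G : SimpleGraph (Fin n)) : ℕ := Nat.card G.edgeSet

/-- The chromatic quasisymmetric function of `G` is palindromic. -/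
def cqfPalindromic {n : ℕ} (G : SimpleGraph (Fin n)) : Prop :=
  ∀ L : List ℕ, IsComposition n L →
    ∀ k : ℕ, k ≤ edgeCount G → NG G L k = NG G L (edgeCount G - k)

/-- The labeled path `P_w` of a permutation `w` of `Fin n`: edges `{w i, w (i+1)}`. -/
def pathGraph {n : ℕ} (w : Equiv.Perm (Fin n)) : SimpleGraph (Fin n) :=
  SimpleGraph.fromRel (fun u v => ∃ i : ℕ, ∃ h : i + 1 < n,
    u = w ⟨i, by omega⟩ ∧ v = w ⟨i + 1, h⟩)

/-- The flipped labeled graph: `uv` is an edge iff `(n+1-u)(n+1-v)` is an edge of `G`. -/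
def flipGraph {n : ℕ} (G : SimpleGraph (Fin n)) : SimpleGraph (Fin n) :=
  SimpleGraph.comap Fin.rev G

/-- The ascent-descent pattern of `w`, where `true` records an ascent (`a`) and
`false` records a descent (`d`). -/
def adPattern {n : ℕ} (w : Equiv.Perm (Fin n)) : List Bool :=
  List.ofFn (fun i : Fin (n - 1) =>
    decide (w ⟨(i : ℕ), by have := i.isLt; omega⟩ < w ⟨(i : ℕ) + 1, by have := i.isLt; omega⟩))

/-- The ribbon word `a^{α₁-1} d a^{α₂-1} d ⋯ d a^{α_ℓ-1}` of a composition. -/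
def ribbonWord : List ℕ → List Bool
  | [] => []
  | [a] => List.replicate (a - 1) true
  | a :: b :: rest => List.replicate (a - 1) true ++ false :: ribbonWord (b :: rest)

/-- Position `i` is a local minimum of `w`. -/
def LocalMinAt {n : ℕ} (w : Equiv.Perm (Fin n)) (i : Fin n) : Prop :=
  (∀ _ : 0 < (i : ℕ), w i < w ⟨(i : ℕ) - 1, by have := i.isLt; omega⟩) ∧
  (∀ h : (i : ℕ) + 1 < n, w i < w ⟨(i : ℕ) + 1, h⟩)

/-- Position `i` is a local maximum of `w`. -/
def LocalMaxAt {n : ℕ} (w : Equiv.Perm (Fin n)) (i : Fin n) : Prop :=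
  (∀ _ : 0 < (i : ℕ), w ⟨(i : ℕ) - 1, by have := i.isLt; omega⟩ < w i) ∧
  (∀ h : (i : ℕ) + 1 < n, w ⟨(i : ℕ) + 1, h⟩ < w i)

/-- The labeled star `K_{1,n-1}` with central vertex `j`. -/
def starGraph (n : ℕ) (j : Fin n) : SimpleGraph (Fin n) :=
  SimpleGraph.fromRel (fun u v => u = j ∧ v ≠ j)

/-- The word `d^{α₁-1} a d^{α₂-1} a ⋯ a d^{α_ℓ-1}` of a composition. -/
def coribbonWord : List ℕ → List Bool
  | [] => []
  | [a] => List.replicate (a - 1) false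
  | a :: b :: rest => List.replicate (a - 1) false ++ true :: coribbonWord (b :: rest)

/-- The number of ascending positions of a descent predicate `D` before `p`; two positions lie
in the same descending run exactly when these numbers agree. -/
noncomputable def runIndex (D : ℕ → Prop) (p : ℕ) : ℕ :=
  @Nat.count (fun i => ¬ D i) (Classical.decPred _) p

lemma runIndex_mono (D : ℕ → Prop) : Monotone (runIndex D) :=
  @Nat.count_monotone _ (Classical.decPred _)

lemma runIndex_lt {D : ℕ → Prop} {p q : ℕ} (hp : ¬ D p) (h : p < q) :
    runIndex D p < runIndex D q :=
  @Nat.count_strict_mono (fun i => ¬ D i) (Classical.decPred _) _ _ hp h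

lemma runIndex_eq_zero {D : ℕ → Prop} {p : ℕ} (h : ∀ i < p, D i) : runIndex D p = 0 :=
  @Nat.count_of_forall_not _ (Classical.decPred _) _ fun i hi => not_not_intro (h i hi)

lemma runIndex_succ_of_descent {D : ℕ → Prop} {p : ℕ} (h : D p) :
    runIndex D (p + 1) = runIndex D p := by
  rw [runIndex, Nat.count_succ, if_neg (not_not_intro h), runIndex, add_zero]

lemma runIndex_succ_of_not {D : ℕ → Prop} {p : ℕ} (h : ¬ D p) :
    runIndex D (p + 1) = runIndex D p + 1 := by
  rw [runIndex, Nat.count_succ, if_pos h, runIndex]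

/-- `x` decreases strictly at every position where `D` holds. -/
def DecreasesOn {n : ℕ} (D : ℕ → Prop) (x : Fin n → ℕ) : Prop :=
  ∀ (p : ℕ) (h : p + 1 < n), D p → x ⟨p + 1, h⟩ < x ⟨p, by omega⟩

/-- `x` increases strictly at every position where `D` fails. -/
def IncreasesOff {n : ℕ} (D : ℕ → Prop) (x : Fin n → ℕ) : Prop :=
  ∀ (p : ℕ) (h : p + 1 < n), ¬ D p → x ⟨p, by omega⟩ < x ⟨p + 1, h⟩

lemma DecreasesOn.lt {n : ℕ} {D : ℕ → Prop} {x : Fin n → ℕ} (hx : DecreasesOn D x)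
    {p q : Fin n} (hpq : p < q) (hr : runIndex D p = runIndex D q) : x q < x p := by
  obtain ⟨p, hp⟩ := p
  obtain ⟨q, hq⟩ := q
  simp only [Fin.mk_lt_mk] at hpq hr
  induction q, hpq using Nat.le_induction with
  | base =>
    refine hx p hq ?_
    by_contra hD
    exact absurd hr (runIndex_lt hD (Nat.lt_succ_self p)).ne
  | succ q hpq ih =>
    have h1 := runIndex_mono D (show p ≤ q by omega)
    have h2 := runIndex_mono D (show q ≤ q + 1 by omega)
    refine lt_trans (hx q hq ?_) (ih (by omega) (by omega))
    by_contra hD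
    have := runIndex_lt hD (Nat.lt_succ_self q)
    simp only [Nat.succ_eq_add_one] at this
    omega

lemma DecreasesOn.le {n : ℕ} {D : ℕ → Prop} {x : Fin n → ℕ} (hx : DecreasesOn D x)
    {p q : Fin n} (hpq : p ≤ q) (hr : runIndex D p = runIndex D q) : x q ≤ x p := by
  rcases hpq.eq_or_lt with rfl | h
  · exact le_rfl
  · exact (hx.lt h hr).le

lemma natCard_fin_subtype {n : ℕ} (P : ℕ → Prop) [DecidablePred P] :
    Nat.card {v : Fin n // P v} = Nat.count P n := by
  let := Nat.CountSet.fintype P n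
  rw [Nat.count_eq_card_fintype, ← Nat.card_eq_fintype_card]
  refine Nat.card_congr ⟨fun v => ⟨v.1, v.1.2, v.2⟩, fun k => ⟨⟨k.1, k.2.1⟩, k.2.2⟩, ?_, ?_⟩
  · intro v; rfl
  · intro k; rfl

lemma natCard_not {n : ℕ} (D : ℕ → Prop) :
    Nat.card {v : Fin n // ¬ D v} = runIndex D n := by
  classical
  unfold runIndex
  convert natCard_fin_subtype (n := n) (fun i => ¬ D i)

/-- A color used once per descending run on average is used in every descending run. -/
lemma DecreasesOn.exists_mem_run {n : ℕ} {D : ℕ → Prop} (hD : ∀ p, D p → p + 1 < n)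
    {x : Fin n → ℕ} (hx : DecreasesOn D x) {c : ℕ}
    (hc : Nat.card {v : Fin n // x v = c} = runIndex D n) (p : Fin n) :
    ∃ q : Fin n, runIndex D q = runIndex D p ∧ x q = c := by
  classical
  have hlt : ∀ q : Fin n, runIndex D q < runIndex D n := fun q =>
    (runIndex_mono D (show (q : ℕ) ≤ n - 1 by omega)).trans_lt
      (runIndex_lt (p := n - 1) (fun h => by have := hD _ h; omega)
        (by have := q.2; omega))
  let S : Finset (Fin n) := Finset.univ.filter (fun v => x v = c)
  have hS : S.card = runIndex D n := by
    rw [← hc, Nat.card_eq_fintype_card, Fintype.card_subtype]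
  have hinj : Set.InjOn (fun v : Fin n => runIndex D v) S := by
    intro u hu v hv huv
    simp only [S, Finset.coe_filter, Finset.mem_univ, true_and, Set.mem_ofPred_eq] at hu hv
    rcases lt_trichotomy u v with h | h | h
    · have := hx.lt h huv; omega
    · exact h
    · have := hx.lt h huv.symm; omega
  have himg : S.image (fun v : Fin n => runIndex D v) = Finset.range (runIndex D n) := by
    apply Finset.eq_of_subset_of_card_le
    · intro j hj
      obtain ⟨v, -, rfl⟩ := Finset.mem_image.1 hj
      exact Finset.mem_range.2 (hlt v)
    · rw [Finset.card_range, Finset.card_image_of_injOn hinj, hS]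
  have hp : runIndex D p ∈ S.image (fun v : Fin n => runIndex D v) := by
    rw [himg]; exact Finset.mem_range.2 (hlt p)
  obtain ⟨q, hq, hqp⟩ := Finset.mem_image.1 hp
  exact ⟨q, hqp, (Finset.mem_filter.1 hq).2⟩

open Classical in
/-- Within each descending run, replace the color `c` by the new smallest color `1`, raise the
colors below `c` by one, and sort the run again. -/
noncomputable def lowerColor {n : ℕ} (D : ℕ → Prop) (c : ℕ) (x : Fin n → ℕ) (p : Fin n) : ℕ :=
  if c < x p then x p
  else if h : (p : ℕ) + 1 < n ∧ D p then x ⟨p + 1, h.1⟩ + 1 else 1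

section LowerColor

variable {n : ℕ} {D : ℕ → Prop} {c : ℕ} {x : Fin n → ℕ}

lemma lowerColor_of_lt {p : Fin n} (h : c < x p) : lowerColor D c x p = x p := by
  simp [lowerColor, h]

lemma lowerColor_of_descent {p : ℕ} (h : p + 1 < n) (hp : D p) (hc : x ⟨p, by omega⟩ ≤ c) :
    lowerColor D c x ⟨p, by omega⟩ = x ⟨p + 1, h⟩ + 1 := by
  simp [lowerColor, not_lt.2 hc, h, hp]

lemma lowerColor_of_not {p : Fin n} (hp : ¬ D p) (hc : x p ≤ c) :
    lowerColor D c x p = 1 := by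
  simp [lowerColor, not_lt.2 hc, hp]

lemma lowerColor_le (hx : DecreasesOn D x) (hpos : ∀ v, 1 ≤ x v) {p : Fin n} :
    lowerColor D c x p ≤ x p := by
  unfold lowerColor
  split_ifs with h1 h2
  · exact le_rfl
  · exact hx p h2.1 h2.2
  · exact hpos p

lemma one_le_lowerColor (hpos : ∀ v, 1 ≤ x v) (p : Fin n) : 1 ≤ lowerColor D c x p := by
  unfold lowerColor
  split_ifs with h1 h2
  · exact hpos p
  · omega
  · exact le_rfl

lemma lt_lowerColor_iff (hx : DecreasesOn D x) (hpos : ∀ v, 1 ≤ x v) {p : Fin n} :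
    c < lowerColor D c x p ↔ c < x p := by
  refine ⟨fun h => h.trans_le (lowerColor_le hx hpos), fun h => ?_⟩
  rwa [lowerColor_of_lt h]

lemma le_of_not_descent (hx : DecreasesOn D x)
    (hmem : ∀ p : Fin n, ∃ q : Fin n, runIndex D q = runIndex D p ∧ x q = c)
    {p : Fin n} (hp : ¬ D p) : x p ≤ c := by
  obtain ⟨q, hq, rfl⟩ := hmem p
  refine hx.le ?_ hq
  by_contra! h
  exact absurd hq (runIndex_lt hp h).ne'

lemma exists_pred_of_lt (hx : DecreasesOn D x)
    (hmem : ∀ p : Fin n, ∃ q : Fin n, runIndex D q = runIndex D p ∧ x q = c)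
    {q : Fin n} (hq : x q < c) :
    ∃ (p : ℕ) (h : p + 1 < n), D p ∧ x ⟨p, by omega⟩ ≤ c ∧ q = ⟨p + 1, h⟩ := by
  obtain ⟨s, hs, rfl⟩ := hmem q
  have hsq : s < q := by
    by_contra! h
    have := hx.le h hs.symm
    omega
  obtain ⟨q, hqn⟩ := q
  obtain ⟨s, hsn⟩ := s
  simp only [Fin.mk_lt_mk] at hsq hs
  obtain ⟨p, rfl⟩ : ∃ p, q = p + 1 := ⟨q - 1, by omega⟩
  have h1 := runIndex_mono D (show s ≤ p by omega)
  have h2 := runIndex_mono D (show p ≤ p + 1 by omega)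
  refine ⟨p, hqn, ?_, ?_, rfl⟩
  · by_contra hp
    have := runIndex_lt hp (Nat.lt_add_one p)
    omega
  · refine hx.le (p := ⟨s, hsn⟩) (q := ⟨p, by omega⟩) ?_ ?_
    · simp only [Fin.mk_le_mk]; omega
    · simp only; omega

lemma lowerColor_injective {x' : Fin n → ℕ} (hx : DecreasesOn D x) (hx' : DecreasesOn D x')
    (hpos : ∀ v, 1 ≤ x v) (hpos' : ∀ v, 1 ≤ x' v)
    (hmem : ∀ p : Fin n, ∃ q : Fin n, runIndex D q = runIndex D p ∧ x q = c)
    (hmem' : ∀ p : Fin n, ∃ q : Fin n, runIndex D q = runIndex D p ∧ x' q = c)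
    (h : lowerColor D c x = lowerColor D c x') : x = x' := by
  have key : ∀ p, c < x p ↔ c < x' p := fun p => by
    rw [← lt_lowerColor_iff (D := D) hx hpos, h, lt_lowerColor_iff hx' hpos']
  ext q
  by_cases hq : c < x q
  · rw [← lowerColor_of_lt (D := D) hq, h, lowerColor_of_lt ((key q).1 hq)]
  have hq' := mt (key q).2 hq
  by_cases h1 : x q < c
  · obtain ⟨p, hp, hDp, hle, rfl⟩ := exists_pred_of_lt hx hmem h1
    have e1 := lowerColor_of_descent hp hDp hle
    have e2 := lowerColor_of_descent (x := x') (c := c) hp hDp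
      (not_lt.1 (mt (key _).2 (not_lt.2 hle)))
    rw [h] at e1
    omega
  by_cases h2 : x' q < c
  · obtain ⟨p, hp, hDp, hle, rfl⟩ := exists_pred_of_lt hx' hmem' h2
    have e1 := lowerColor_of_descent hp hDp hle
    have e2 := lowerColor_of_descent (x := x) (c := c) hp hDp
      (not_lt.1 (mt (key _).1 (not_lt.2 hle)))
    rw [h] at e2
    omega
  omega

lemma decreasesOn_lowerColor (hx : DecreasesOn D x) (hpos : ∀ v, 1 ≤ x v) :
    DecreasesOn D (lowerColor D c x) := by
  intro p h hp
  have h1 := hx p h hp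
  have h2 := lowerColor_le (D := D) (c := c) hx hpos (p := ⟨p + 1, h⟩)
  by_cases hc : x ⟨p, by omega⟩ ≤ c
  · rw [lowerColor_of_descent h hp hc]
    omega
  · rw [lowerColor_of_lt (p := ⟨p, by omega⟩) (not_le.1 hc)]
    omega

lemma increasesOff_lowerColor (hx : DecreasesOn D x) (hpos : ∀ v, 1 ≤ x v)
    (hmem : ∀ p : Fin n, ∃ q : Fin n, runIndex D q = runIndex D p ∧ x q = c)
    (hD : ∀ p, p + 1 < n → ¬ D p → p + 2 < n ∧ D (p + 1)) (hc : 1 ≤ c) :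
    IncreasesOff D (lowerColor D c x) := by
  intro p h hp
  rw [lowerColor_of_not (p := ⟨p, by omega⟩) hp (le_of_not_descent hx hmem hp)]
  obtain ⟨h', hp'⟩ := hD p h hp
  by_cases hc' : x ⟨p + 1, h⟩ ≤ c
  · rw [lowerColor_of_descent h' hp' hc']
    have := hpos ⟨p + 1 + 1, h'⟩
    omega
  · rw [lowerColor_of_lt (not_le.1 hc')]
    omega

lemma natCard_lowerColor_eq_of_lt (hx : DecreasesOn D x) (hpos : ∀ v, 1 ≤ x v) {a : ℕ}
    (ha : c < a) :
    Nat.card {v // lowerColor D c x v = a} = Nat.card {v // x v = a} := by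
  refine Nat.card_congr (Equiv.subtypeEquivRight fun v => ⟨fun h => ?_, fun h => ?_⟩)
  · have : c < x v := (lt_lowerColor_iff (D := D) hx hpos).1 (h ▸ ha)
    rwa [lowerColor_of_lt this] at h
  · rwa [lowerColor_of_lt (h ▸ ha)]

lemma natCard_lowerColor_eq_one (hx : DecreasesOn D x) (hpos : ∀ v, 1 ≤ x v)
    (hmem : ∀ p : Fin n, ∃ q : Fin n, runIndex D q = runIndex D p ∧ x q = c)
    (hD : ∀ p, D p → p + 1 < n) (hc : 1 ≤ c) :
    Nat.card {v // lowerColor D c x v = 1} = runIndex D n := by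
  rw [← natCard_not]
  refine Nat.card_congr (Equiv.subtypeEquivRight fun v => ⟨fun h hv => ?_, fun h => ?_⟩)
  · by_cases hcv : x v ≤ c
    · have := lowerColor_of_descent (hD _ hv) hv hcv
      have := hpos ⟨v + 1, hD _ hv⟩
      simp only [Fin.eta] at *
      omega
    · rw [lowerColor_of_lt (not_le.1 hcv)] at h
      omega
  · exact lowerColor_of_not h (le_of_not_descent hx hmem h)

lemma natCard_lowerColor_eq_succ (hx : DecreasesOn D x)
    (hmem : ∀ p : Fin n, ∃ q : Fin n, runIndex D q = runIndex D p ∧ x q = c)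
    {a : ℕ} (ha : 1 ≤ a) (hac : a < c) :
    Nat.card {v // lowerColor D c x v = a + 1} = Nat.card {v // x v = a} := by
  have key : ∀ v : Fin n, lowerColor D c x v = a + 1 →
      ∃ h : (v : ℕ) + 1 < n, x ⟨v + 1, h⟩ = a := by
    intro v hv
    unfold lowerColor at hv
    split_ifs at hv with h1 h2
    · omega
    · exact ⟨h2.1, by omega⟩
    · omega
  refine Nat.card_eq_of_bijective
    (fun v => ⟨⟨v.1 + 1, (key v.1 v.2).1⟩, (key v.1 v.2).2⟩) ⟨?_, ?_⟩
  · intro u v huv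
    simp only [Subtype.mk.injEq, Fin.mk.injEq] at huv
    exact Subtype.ext (Fin.ext (by omega))
  · rintro ⟨q, hq⟩
    obtain ⟨p, h, hp, hle, rfl⟩ := exists_pred_of_lt hx hmem (hq ▸ hac : x q < c)
    exact ⟨⟨⟨p, by omega⟩, by rw [lowerColor_of_descent h hp hle, hq]⟩, rfl⟩

end LowerColor

open Classical in
/-- The distance of a position from the start of its descending run. -/
noncomputable def runOffset (D : ℕ → Prop) : ℕ → ℕ
  | 0 => 0
  | p + 1 => if D p then runOffset D p + 1 else 0

lemma runOffset_succ_of_descent {D : ℕ → Prop} {p : ℕ} (h : D p) :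
    runOffset D (p + 1) = runOffset D p + 1 := by simp [runOffset, h]

lemma runOffset_succ_of_not {D : ℕ → Prop} {p : ℕ} (h : ¬ D p) :
    runOffset D (p + 1) = 0 := by simp [runOffset, h]

lemma runOffset_eq_self {D : ℕ → Prop} {p : ℕ} (h : ∀ i < p, D i) : runOffset D p = p := by
  induction p with
  | zero => rfl
  | succ p ih => rw [runOffset_succ_of_descent (h p (by omega)), ih fun i hi => h i (by omega)]

lemma exists_runOffset_eq {D : ℕ → Prop} {e : ℕ} (he : ¬ D e) {p : ℕ} (hp : e < p)
    {m : ℕ} (hm : m ≤ runOffset D p) : ∃ q, e < q ∧ q ≤ p ∧ runOffset D q = m := by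
  induction p, hp using Nat.le_induction with
  | base =>
    rw [Nat.succ_eq_add_one, runOffset_succ_of_not he] at hm
    exact ⟨e + 1, by omega, by omega, by rw [runOffset_succ_of_not he]; omega⟩
  | succ p hp ih =>
    by_cases hD : D p
    · rw [runOffset_succ_of_descent hD] at hm
      rcases Nat.lt_or_ge (runOffset D p) m with h | h
      · exact ⟨p + 1, by omega, le_rfl, by rw [runOffset_succ_of_descent hD]; omega⟩
      · obtain ⟨q, h1, h2, h3⟩ := ih h
        exact ⟨q, h1, by omega, h3⟩
    · rw [runOffset_succ_of_not hD] at hm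
      exact ⟨p + 1, by omega, le_rfl, by rw [runOffset_succ_of_not hD]; omega⟩

/-- There is a coloring, decreasing along every run, in which some color `c` occurs in every run
but as the smallest color of the first run and the largest color of the second one. -/
lemma exists_coloring_not_increasing {n : ℕ} {D : ℕ → Prop} (hDn : ∀ p, D p → p + 1 < n)
    (hex : ∃ e, e + 1 < n ∧ ¬ D e) :
    ∃ (N c : ℕ) (x : Fin n → ℕ), 1 ≤ c ∧ c ≤ N ∧ (∀ v, 1 ≤ x v ∧ x v ≤ N) ∧
      (∀ a, 1 ≤ a → a ≤ N → ∃ v, x v = a) ∧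
      Nat.card {v : Fin n // x v = c} = runIndex D n ∧
      DecreasesOn D x ∧ ¬ IncreasesOff D x := by
  classical
  obtain ⟨e, ⟨hen, he⟩, hmin⟩ :
      ∃ e, (e + 1 < n ∧ ¬ D e) ∧ ∀ i < e, D i := by
    refine ⟨Nat.find hex, Nat.find_spec hex, fun i hi => ?_⟩
    have h1 := Nat.find_min hex hi
    have h2 := (Nat.find_spec hex).1
    by_contra h
    exact h1 ⟨by omega, h⟩
  obtain ⟨t, ht, htmax⟩ := (Finset.Ioo e n).exists_max_image (runOffset D)
    ⟨e + 1, Finset.mem_Ioo.2 ⟨by omega, hen⟩⟩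
  rw [Finset.mem_Ioo] at ht
  obtain ⟨c, hc⟩ : ∃ c, c = runOffset D t + 1 := ⟨_, rfl⟩
  let y : ℕ → ℕ := fun p => if p ≤ e then c + e - p else c - runOffset D p
  have hy1 : ∀ p, p ≤ e → y p = c + e - p := fun p hp => by simp [y, hp]
  have hy2 : ∀ p, e < p → y p = c - runOffset D p := fun p hp => by simp [y, not_le.2 hp]
  have hle : ∀ p, e < p → p < n → runOffset D p < c := fun p h1 h2 => by
    have := htmax p (Finset.mem_Ioo.2 ⟨h1, h2⟩)
    omega
  refine ⟨c + e, c, fun v => y v, by omega, by omega, ?_, ?_, ?_, ?_, ?_⟩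
  · intro v
    simp only
    rcases Nat.lt_or_ge e v with h | h
    · have := hle v h v.2
      rw [hy2 v h]; omega
    · rw [hy1 v h]; omega
  · intro a h1 h2
    rcases Nat.lt_or_ge a c with h | h
    · obtain ⟨q, hq1, hq2, hq3⟩ :=
        exists_runOffset_eq he ht.1 (m := c - a) (by omega)
      exact ⟨⟨q, by omega⟩, by simp only; rw [hy2 q hq1]; omega⟩
    · exact ⟨⟨c + e - a, by omega⟩, by simp only; rw [hy1 _ (by omega)]; omega⟩
  · rw [natCard_fin_subtype (fun p => y p = c)]
    have key : ∀ m, e ≤ m → m < n → Nat.count (fun p => y p = c) (m + 1) = 1 + runIndex D m := by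
      intro m hm
      induction m, hm using Nat.le_induction with
      | base =>
        intro _
        rw [Nat.count_succ, if_pos (by rw [hy1 e le_rfl]; omega),
          Nat.count_of_forall_not fun i hi => ?_, runIndex_eq_zero hmin]
        rw [hy1 i hi.le]
        omega
      | succ m hm ih =>
        intro hmn
        have := hle (m + 1) (by omega) hmn
        rw [Nat.count_succ, ih (by omega), hy2 (m + 1) (by omega)]
        by_cases hD : D m
        · rw [runOffset_succ_of_descent hD] at this ⊢
          rw [runIndex_succ_of_descent hD, if_neg (by omega), add_zero]
        · rw [runOffset_succ_of_not hD, runIndex_succ_of_not hD, if_pos (by omega), add_assoc]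
    obtain ⟨m, rfl⟩ : ∃ m, n = m + 1 := ⟨n - 1, by omega⟩
    rw [key m (by omega) (by omega)]
    have hm : ¬ D m := fun h => by have := hDn _ h; omega
    rw [runIndex_succ_of_not hm, add_comm]
  · intro p h hp
    simp only
    rcases lt_trichotomy p e with h1 | rfl | h1
    · rw [hy1 _ h1.le, hy1 _ h1]; omega
    · exact absurd hp he
    · have := hle (p + 1) (by omega) h
      rw [hy2 _ h1, hy2 _ (by omega)]
      rw [runOffset_succ_of_descent hp] at *
      omega
  · intro h
    have := h e hen he
    simp only at this
    rw [hy1 _ le_rfl, hy2 _ (by omega), runOffset_succ_of_not he] at this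
    omega

lemma usesPalette_ofFn {n N : ℕ} {f : Fin N → ℕ} {x : Fin n → ℕ} :
    usesPalette (List.ofFn f) x ↔ (∀ v, 1 ≤ x v ∧ x v ≤ N) ∧
      ∀ i : Fin N, Nat.card {v // x v = (i : ℕ) + 1} = f i := by
  unfold usesPalette
  refine and_congr (by simp) ⟨fun h i => ?_, fun h i => ?_⟩
  · simpa using h (Fin.cast List.length_ofFn.symm i)
  · rw [List.get_ofFn]
    exact h (Fin.cast List.length_ofFn i)

lemma finite_usesPalette {n : ℕ} (L : List ℕ) : {x : Fin n → ℕ | usesPalette L x}.Finite := by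
  refine (Set.Finite.pi' fun _ => Set.finite_Iic L.length).subset fun x hx v => ?_
  exact (hx.1 v).2

lemma usesPalette_lowerColor {n N : ℕ} {D : ℕ → Prop} (hDn : ∀ p, D p → p + 1 < n)
    {f : Fin N → ℕ} {x : Fin n → ℕ} (hx : DecreasesOn D x) (i₀ : Fin N)
    (hf : f i₀ = runIndex D n) (hpal : usesPalette (List.ofFn f) x) :
    usesPalette (List.ofFn (f ∘ i₀.cycleRange.symm)) (lowerColor D (i₀ + 1) x) := by
  rw [usesPalette_ofFn] at hpal ⊢
  obtain ⟨hb, hcard⟩ := hpal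
  have hpos := fun v => (hb v).1
  have hmem := hx.exists_mem_run hDn ((hcard i₀).trans hf)
  refine ⟨fun v => ⟨one_le_lowerColor hpos v, (lowerColor_le hx hpos).trans (hb v).2⟩, fun j => ?_⟩
  obtain ⟨i, rfl⟩ := i₀.cycleRange.surjective j
  simp only [Function.comp_apply, Equiv.symm_apply_apply]
  have : NeZero N := ⟨by have := i.2; omega⟩
  rcases lt_trichotomy i i₀ with h | rfl | h
  · rw [Fin.coe_cycleRange_of_lt h, natCard_lowerColor_eq_succ hx hmem (by omega), hcard]
    have : (i : ℕ) < i₀ := h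
    omega
  · rw [Fin.cycleRange_self, hf]
    exact natCard_lowerColor_eq_one hx hpos hmem hDn (by omega)
  · rw [Fin.cycleRange_of_gt h, natCard_lowerColor_eq_of_lt hx hpos, hcard]
    have : (i₀ : ℕ) < i := h
    omega

/-- A rearrangement of the palette changes the number of colorings that decrease on every
descending run and increase between consecutive runs. -/
theorem exists_perm_ncard_ne {n : ℕ} {D : ℕ → Prop} (hDn : ∀ p, D p → p + 1 < n)
    (hex : ∃ e, e + 1 < n ∧ ¬ D e)
    (hD : ∀ p, p + 1 < n → ¬ D p → p + 2 < n ∧ D (p + 1)) :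
    ∃ L M : List ℕ, IsComposition n L ∧ IsComposition n M ∧ L.Perm M ∧
      {x : Fin n → ℕ | usesPalette L x ∧ DecreasesOn D x ∧ IncreasesOff D x}.ncard ≠
      {x : Fin n → ℕ | usesPalette M x ∧ DecreasesOn D x ∧ IncreasesOff D x}.ncard := by
  classical
  obtain ⟨N, c, x₀, hc, hcN, hb, hsurj, hcard, hdec, hinc⟩ :=
    exists_coloring_not_increasing hDn hex
  let f : Fin N → ℕ := fun i => Nat.card {v // x₀ v = (i : ℕ) + 1}
  let i₀ : Fin N := ⟨c - 1, by omega⟩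
  have hi₀ : (i₀ : ℕ) + 1 = c := by simp only [i₀]; omega
  have hf : f i₀ = runIndex D n := by simp only [f, hi₀, hcard]
  have hpal : usesPalette (List.ofFn f) x₀ := usesPalette_ofFn.2 ⟨hb, fun i => rfl⟩
  have hperm : (List.ofFn (f ∘ i₀.cycleRange.symm)).Perm (List.ofFn f) :=
    Equiv.Perm.ofFn_comp_perm _ _
  have hcomp : IsComposition n (List.ofFn f) := by
    refine ⟨fun a ha => ?_, ?_⟩
    · obtain ⟨i, rfl⟩ := (List.mem_ofFn' _ _).1 ha
      obtain ⟨v, hv⟩ := hsurj (i + 1) (by omega) (by omega)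
      exact Nat.card_pos_iff.2 ⟨⟨⟨v, hv⟩⟩, inferInstance⟩
    · rw [List.sum_ofFn]
      have h := Finset.card_eq_sum_card_fiberwise (s := Finset.univ) (t := Finset.univ)
        (f := fun v : Fin n => (⟨x₀ v - 1, by have := hb v; omega⟩ : Fin N))
        (fun _ _ => Finset.mem_coe.2 (Finset.mem_univ _))
      rw [Finset.card_univ, Fintype.card_fin] at h
      rw [h]
      refine Finset.sum_congr rfl fun i _ => ?_
      simp only [f]
      rw [Nat.card_eq_fintype_card, Fintype.card_subtype]
      congr 1
      ext v
      have := hb v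
      simp only [Finset.mem_filter, Finset.mem_univ, true_and, Fin.ext_iff]
      omega
  refine ⟨_, _, hcomp, ⟨fun a ha => hcomp.1 a (hperm.mem_iff.1 ha), hperm.sum_eq.trans hcomp.2⟩,
    hperm.symm, ne_of_lt ?_⟩
  have hmem : ∀ x : Fin n → ℕ, usesPalette (List.ofFn f) x → DecreasesOn D x →
      ∀ p : Fin n, ∃ q : Fin n, runIndex D q = runIndex D p ∧ x q = c := by
    intro x hp hx
    exact hx.exists_mem_run hDn (by rw [← hi₀, (usesPalette_ofFn.1 hp).2 i₀, hf])
  have hpos : ∀ x : Fin n → ℕ, usesPalette (List.ofFn f) x → ∀ v, 1 ≤ x v :=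
    fun x hp v => (hp.1 v).1
  calc _ < {x : Fin n → ℕ | usesPalette (List.ofFn f) x ∧ DecreasesOn D x}.ncard := by
        refine Set.ncard_lt_ncard ⟨fun x hx => ⟨hx.1, hx.2.1⟩, fun h => ?_⟩
          ((finite_usesPalette _).subset fun x hx => hx.1)
        exact hinc (h (show x₀ ∈ _ from ⟨hpal, hdec⟩)).2.2
    _ ≤ _ := by
        refine Set.ncard_le_ncard_of_injOn (lowerColor D c) ?_ ?_
          ((finite_usesPalette _).subset fun x hx => hx.1)
        · rintro x ⟨hp, hx⟩
          refine ⟨?_, decreasesOn_lowerColor hx (hpos x hp),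
            increasesOff_lowerColor hx (hpos x hp) (hmem x hp hx) hD hc⟩
          rw [← hi₀]
          exact usesPalette_lowerColor hDn hx i₀ hf hp
        · rintro x ⟨hp, hx⟩ y ⟨hpy, hy⟩ h
          exact lowerColor_injective hx hy (hpos x hp) (hpos y hpy) (hmem x hp hx)
            (hmem y hpy hy) h

/-- Position `p` of `w` is followed by a smaller entry. -/
def DescentAt {n : ℕ} (w : Equiv.Perm (Fin n)) (p : ℕ) : Prop :=
  ∃ h : p + 1 < n, w ⟨p + 1, h⟩ < w ⟨p, by omega⟩

lemma pathGraph_adj {n : ℕ} (w : Equiv.Perm (Fin n)) (u v : Fin n) :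
    (pathGraph w).Adj u v ↔ ∃ (i : ℕ) (h : i + 1 < n),
      (u = w ⟨i, by omega⟩ ∧ v = w ⟨i + 1, h⟩) ∨ (v = w ⟨i, by omega⟩ ∧ u = w ⟨i + 1, h⟩) := by
  rw [pathGraph, SimpleGraph.fromRel_adj]
  constructor
  · rintro ⟨-, ⟨i, h, h'⟩ | ⟨i, h, h'⟩⟩
    · exact ⟨i, h, Or.inl h'⟩
    · exact ⟨i, h, Or.inr h'⟩
  · rintro ⟨i, h, ⟨rfl, rfl⟩ | ⟨rfl, rfl⟩⟩
    · exact ⟨by simp [Fin.ext_iff], Or.inl ⟨i, h, rfl, rfl⟩⟩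
    · exact ⟨by simp [Fin.ext_iff], Or.inr ⟨i, h, rfl, rfl⟩⟩

lemma lt_of_not_descentAt {n : ℕ} {w : Equiv.Perm (Fin n)} {p : ℕ} (h : p + 1 < n)
    (hp : ¬ DescentAt w p) : w ⟨p, by omega⟩ < w ⟨p + 1, h⟩ := by
  refine lt_of_le_of_ne (not_lt.1 fun hlt => hp ⟨h, hlt⟩) fun heq => ?_
  simp [Fin.ext_iff] at heq

/-- The ascents of a coloring of `P_w` are the steps along which it varies in the same direction
as `w`. -/
lemma ascNum_pathGraph {n : ℕ} (w : Equiv.Perm (Fin n)) (x : Fin n → ℕ) :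
    ascNum (pathGraph w) (x ∘ w.symm) = Nat.card {i : Fin (n - 1) //
      (DescentAt w i → x ⟨i + 1, by omega⟩ < x ⟨i, by omega⟩) ∧
      (¬ DescentAt w i → x ⟨i, by omega⟩ < x ⟨i + 1, by omega⟩)} := by
  classical
  symm
  let g : Fin (n - 1) → Fin n × Fin n := fun i =>
    if DescentAt w i then (w ⟨i + 1, by omega⟩, w ⟨i, by omega⟩)
    else (w ⟨i, by omega⟩, w ⟨i + 1, by omega⟩)
  refine Nat.card_eq_of_bijective (fun i => ⟨g i.1, ?_⟩) ⟨?_, ?_⟩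
  · obtain ⟨i, hi1, hi2⟩ := i
    simp only [pathGraph_adj, g]
    by_cases hd : DescentAt w i
    · rw [if_pos hd]
      exact ⟨hd.2, ⟨i, by omega, Or.inr ⟨rfl, rfl⟩⟩, by simpa using hi1 hd⟩
    · rw [if_neg hd]
      exact ⟨lt_of_not_descentAt (by omega) hd, ⟨i, by omega, Or.inl ⟨rfl, rfl⟩⟩,
        by simpa using hi2 hd⟩
  · rintro ⟨i, hi⟩ ⟨j, hj⟩ hij
    simp only [Subtype.mk.injEq, g] at hij
    ext
    simp only
    split_ifs at hij <;>
      simp only [Prod.mk.injEq, EmbeddingLike.apply_eq_iff_eq, Fin.mk.injEq] at hij <;> omega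
  · rintro ⟨⟨u, v⟩, huv, hadj, hc⟩
    simp only at huv hc
    obtain ⟨i, h, ⟨rfl, rfl⟩ | ⟨rfl, rfl⟩⟩ := (pathGraph_adj w u v).1 hadj
    · have hd : ¬ DescentAt w i := fun h' => absurd h'.2 huv.asymm
      refine ⟨⟨⟨i, by omega⟩, fun h' => absurd h' hd, fun _ => by simpa using hc⟩, ?_⟩
      simp [g, hd]
    · have hd : DescentAt w i := ⟨h, huv⟩
      refine ⟨⟨⟨i, by omega⟩, fun _ => by simpa using hc, fun h' => absurd hd h'⟩, ?_⟩
      simp [g, hd]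

lemma ascNum_pathGraph_eq_iff {n : ℕ} (w : Equiv.Perm (Fin n)) (x : Fin n → ℕ) :
    ascNum (pathGraph w) (x ∘ w.symm) = n - 1 ↔
      DecreasesOn (DescentAt w) x ∧ IncreasesOff (DescentAt w) x := by
  classical
  rw [ascNum_pathGraph, Nat.card_eq_fintype_card]
  constructor
  · intro h
    have key := fun i => by_contra fun hi => (Fintype.card_subtype_lt (x := i) hi).ne
      (h.trans (Fintype.card_fin _).symm)
    exact ⟨fun p hp => (key ⟨p, by omega⟩).1, fun p hp => (key ⟨p, by omega⟩).2⟩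
  · rintro ⟨h1, h2⟩
    conv_rhs => rw [← Fintype.card_fin (n - 1)]
    refine Fintype.card_of_bijective (f := Subtype.val) ⟨Subtype.val_injective, fun i => ?_⟩
    exact ⟨⟨i, h1 i (by omega), h2 i (by omega)⟩, rfl⟩

lemma usesPalette_comp_symm {n : ℕ} (w : Equiv.Perm (Fin n)) (L : List ℕ) (x : Fin n → ℕ) :
    usesPalette L (x ∘ w.symm) ↔ usesPalette L x := by
  have h : ∀ a, Nat.card {v // (x ∘ w.symm) v = a} = Nat.card {v // x v = a} := fun a =>
    Nat.card_congr (w.symm.subtypeEquiv fun v => by rfl)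
  simp only [usesPalette, h]
  exact and_congr_left' (w.symm.forall_congr fun v => Iff.rfl)

lemma properColoring_pathGraph {n : ℕ} (w : Equiv.Perm (Fin n)) {x : Fin n → ℕ}
    (h1 : DecreasesOn (DescentAt w) x) (h2 : IncreasesOff (DescentAt w) x) :
    properColoring (pathGraph w) (x ∘ w.symm) := by
  have key : ∀ i (h : i + 1 < n), x ⟨i, by omega⟩ ≠ x ⟨i + 1, h⟩ := fun i h => by
    by_cases hd : DescentAt w i
    · exact (h1 i h hd).ne'
    · exact (h2 i h hd).ne
  intro u v huv
  obtain ⟨i, h, ⟨rfl, rfl⟩ | ⟨rfl, rfl⟩⟩ := (pathGraph_adj w u v).1 huv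
  · simpa using key i h
  · simpa using (key i h).symm

lemma NG_pathGraph_pred {n : ℕ} (w : Equiv.Perm (Fin n)) (L : List ℕ) :
    NG (pathGraph w) L (n - 1) = {x : Fin n → ℕ | usesPalette L x ∧
      DecreasesOn (DescentAt w) x ∧ IncreasesOff (DescentAt w) x}.ncard := by
  rw [NG, ← Nat.card_coe_set_eq]
  refine Nat.card_congr (Equiv.symm ((w.arrowCongr (Equiv.refl ℕ)).subtypeEquiv fun x => ?_))
  have : (w.arrowCongr (Equiv.refl ℕ)) x = x ∘ w.symm := rfl
  rw [this, usesPalette_comp_symm, ascNum_pathGraph_eq_iff]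
  exact ⟨fun ⟨h1, h2⟩ => ⟨properColoring_pathGraph w h2.1 h2.2, h1, h2⟩, fun h => h.2⟩

lemma coribbonWord_getElem?_zero {a : ℕ} {l : List ℕ} (ha : 2 ≤ a) :
    (coribbonWord (a :: l))[0]? = some false := by
  obtain ⟨a, rfl⟩ : ∃ b, a = b + 2 := ⟨a - 2, by omega⟩
  cases l <;> simp [coribbonWord, List.replicate_succ]

lemma coribbonWord_getElem?_succ {l : List ℕ} (hl : ∀ a ∈ l, 2 ≤ a) {i : ℕ}
    (hi : (coribbonWord l)[i]? = some true) : (coribbonWord l)[i + 1]? = some false := by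
  induction l generalizing i with
  | nil => simp [coribbonWord] at hi
  | cons a l ih =>
    cases l with
    | nil => simp [coribbonWord, List.getElem?_replicate] at hi
    | cons b l =>
      simp only [coribbonWord, List.getElem?_append, List.length_replicate,
        List.getElem?_replicate] at hi ⊢
      rcases lt_trichotomy i (a - 1) with h | h | h
      · simp [h] at hi
      · rw [if_neg (by omega), show i + 1 - (a - 1) = 0 + 1 by omega, List.getElem?_cons_succ]
        exact coribbonWord_getElem?_zero (hl b (by simp))
      · rw [if_neg (by omega), show i - (a - 1) = (i - (a - 1) - 1) + 1 by omega,
          List.getElem?_cons_succ] at hi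
        rw [if_neg (by omega), show i + 1 - (a - 1) = (i - (a - 1) - 1 + 1) + 1 by omega,
          List.getElem?_cons_succ]
        exact ih (fun c hc => hl c (by simp [hc])) hi

lemma exists_coribbonWord_getElem?_eq_true {l : List ℕ} (hl : 2 ≤ l.length) :
    ∃ i : ℕ, (coribbonWord l)[i]? = some true := by
  match l, hl with
  | a :: b :: l, _ => exact ⟨a - 1, by simp [coribbonWord]⟩

lemma adPattern_getElem?_eq_true {n : ℕ} (w : Equiv.Perm (Fin n)) (p : ℕ) :
    (adPattern w)[p]? = some true ↔ p + 1 < n ∧ ¬ DescentAt w p := by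
  by_cases h : p + 1 < n
  · have hp : p < n - 1 := by omega
    simp only [adPattern, List.getElem?_ofFn, hp, dite_true, Option.some.injEq,
      decide_eq_true_eq, h, true_and]
    exact ⟨fun h1 h2 => absurd h2.2 h1.asymm, lt_of_not_descentAt h⟩
  · have hp : ¬ p < n - 1 := by omega
    simp [adPattern, hp, h]

lemma adPattern_getElem?_eq_false {n : ℕ} (w : Equiv.Perm (Fin n)) (p : ℕ) :
    (adPattern w)[p]? = some false → DescentAt w p := by
  intro hf
  by_contra hd
  by_cases h : p + 1 < n
  · rw [(adPattern_getElem?_eq_true w p).2 ⟨h, hd⟩] at hf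
    simp at hf
  · have hp : ¬ p < n - 1 := by omega
    simp [adPattern, hp] at hf

/-- If the ad-pattern of `w` is `d^{α₁-1} a d^{α₂-1} a ⋯ a d^{α_k-1}`
for a composition `(α₁,…,α_k)` of `n` with `k ≥ 2` parts all of size at least `2`,
then the CQF of `P_w` is not symmetric. -/
theorem stmt7 (n : ℕ) (w : Equiv.Perm (Fin n)) (α : List ℕ)
    (hcomp : IsComposition n α) (hrib : adPattern w = coribbonWord α)
    (hlen : 2 ≤ α.length) (h2 : ∀ a ∈ α, 2 ≤ a) :
    ¬ cqfSymmetric (pathGraph w) := by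
  have hasc : ∃ e, e + 1 < n ∧ ¬ DescentAt w e := by
    obtain ⟨i, hi⟩ := exists_coribbonWord_getElem?_eq_true hlen
    rw [← hrib] at hi
    exact ⟨i, (adPattern_getElem?_eq_true w i).1 hi⟩
  have hdes : ∀ p, p + 1 < n → ¬ DescentAt w p → p + 2 < n ∧ DescentAt w (p + 1) := by
    intro p hp hd
    have h := (adPattern_getElem?_eq_true w p).2 ⟨hp, hd⟩
    rw [hrib] at h
    have h' := coribbonWord_getElem?_succ h2 h
    rw [← hrib] at h'
    have hd' := adPattern_getElem?_eq_false w _ h'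
    exact ⟨hd'.1, hd'⟩
  obtain ⟨L, M, hL, hM, hLM, hne⟩ := exists_perm_ncard_ne (fun p hp => hp.1) hasc hdes
  intro hsym
  exact hne (by rw [← NG_pathGraph_pred, ← NG_pathGraph_pred, hsym L M hL hM hLM])
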